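/- arXiv:2404.04873 — 3 statements merged into one kernel-verified Lean document; each statement's English description precedes it below -/
import Mathlib

section
/- Let D be an n-atomic domain, let x ∈ D^#, and let A = {a₁, …, a_m} be a facet of the irreducible divisor simplicial complex S(x), i.e., a face of S(x) that is maximal with respect to inclusion. Then x admits a factorization x = x₁x₂⋯x_k into irreducible elements of D such that the set of association classes of the factors x₁, …, x_k equals the set of association classes of the elements of A. -/
/-- `a` is a nonzero nonunit (membership in `D^#`). -/
def NNU {D : Type*} [Ring D] (a : D) : Prop := a ≠ 0 ∧ ¬ IsUnit a

/-- `a ∣ b` in the sense of the paper: `b = c * a * d` for some `c, d`. -/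
def PDvd {D : Type*} [Ring D] (a b : D) : Prop := ∃ c d : D, b = c * a * d

/-- `a ~ b`: `a = u * b * v` for units `u, v`. -/
def PAssoc {D : Type*} [Ring D] (a b : D) : Prop :=
  ∃ u v : Dˣ, a = (u : D) * b * (v : D)

/-- `a` is irreducible: a nonzero nonunit that is not a product of two nonunits. -/
def PIrred {D : Type*} [Ring D] (a : D) : Prop :=
  NNU a ∧ ∀ y z : D, a = y * z → IsUnit y ∨ IsUnit z

/-- `a` is normal: `aD = Da`. -/
def PNormal {D : Type*} [Ring D] (a : D) : Prop :=
  {x : D | ∃ d : D, x = a * d} = {x : D | ∃ d : D, x = d * a}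
/-- `D` is n-atomic: every nonzero nonunit is a product of normal irreducible elements. -/
def NAtomic (D : Type*) [Ring D] : Prop :=
  ∀ a : D, NNU a → ∃ l : List D, l ≠ [] ∧ (∀ p ∈ l, PNormal p ∧ PIrred p) ∧ a = l.prod

/-- A factorization of `r` into normal irreducible elements. -/
def NFactorization {D : Type*} [Ring D] (r : D) (l : List D) : Prop :=
  (∀ p ∈ l, PNormal p ∧ PIrred p) ∧ r = l.prod

/-- `D` is an n-UFD: n-atomic, and factorizations into normal irreducibles are
unique up to order and associates. -/
def NUFD (D : Type*) [Ring D] : Prop :=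
  NAtomic D ∧ ∀ r : D, NNU r → ∀ l t : List D, NFactorization r l → NFactorization r t →
    ∃ σ : Fin l.length ≃ Fin t.length, ∀ i, PAssoc (l.get i) (t.get (σ i))
/-- `A` is a face of the irreducible divisor simplicial complex `S x`:
a finite set of pairwise nonassociate irreducible divisors of `x`, some ordering
of which has product dividing `x`. -/
def IsFace {D : Type*} [Ring D] (x : D) (A : Finset D) : Prop :=
  (∀ a ∈ A, PIrred a ∧ PDvd a x) ∧
  (∀ a ∈ A, ∀ b ∈ A, a ≠ b → ¬ PAssoc a b) ∧
  ∃ l : List D, l.Nodup ∧ (∀ a : D, a ∈ l ↔ a ∈ A) ∧ PDvd l.prod x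

section Normal

variable {D : Type*} [Ring D]

theorem PNormal.of_isUnit {a : D} (ha : IsUnit a) : PNormal a := by
  obtain ⟨u, rfl⟩ := ha
  ext x
  exact ⟨fun _ => ⟨x * ↑u⁻¹, by simp⟩, fun _ => ⟨↑u⁻¹ * x, by simp⟩⟩

theorem PNormal.exists_mul_eq_mul {a : D} (ha : PNormal a) (d : D) : ∃ e, a * d = e * a :=
  ha.subset ⟨d, rfl⟩

theorem PNormal.exists_mul_eq_mul' {a : D} (ha : PNormal a) (d : D) : ∃ e, d * a = a * e :=
  ha.superset ⟨d, rfl⟩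

theorem PNormal.mul {a b : D} (ha : PNormal a) (hb : PNormal b) : PNormal (a * b) := by
  ext x
  constructor
  · rintro ⟨d, rfl⟩
    obtain ⟨e, he⟩ := hb.exists_mul_eq_mul d
    obtain ⟨f, hf⟩ := ha.exists_mul_eq_mul e
    exact ⟨f, by rw [mul_assoc, he, ← mul_assoc, hf, mul_assoc]⟩
  · rintro ⟨d, rfl⟩
    obtain ⟨e, he⟩ := ha.exists_mul_eq_mul' d
    obtain ⟨f, hf⟩ := hb.exists_mul_eq_mul' e
    exact ⟨f, by rw [← mul_assoc, he, mul_assoc, hf, mul_assoc]⟩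

theorem PNormal.list_prod {l : List D} (hl : ∀ p ∈ l, PNormal p) : PNormal l.prod :=
  l.prod_induction PNormal (fun _ _ => PNormal.mul) (.of_isUnit isUnit_one) hl

/-- In an n-atomic ring every element is normal. -/
theorem NAtomic.pNormal (hD : NAtomic D) (a : D) : PNormal a := by
  by_cases h0 : a = 0
  · subst h0
    simp [PNormal]
  by_cases hu : IsUnit a
  · exact .of_isUnit hu
  obtain ⟨l, -, hl, rfl⟩ := hD a ⟨h0, hu⟩
  exact .list_prod fun p hp => (hl p hp).1

theorem PAssoc.refl (a : D) : PAssoc a a := ⟨1, 1, by simp⟩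

theorem PAssoc.symm {a b : D} : PAssoc a b → PAssoc b a := by
  rintro ⟨u, v, rfl⟩
  exact ⟨u⁻¹, v⁻¹, by simp [mul_assoc]⟩

theorem PIrred.mul_unit {a : D} (ha : PIrred a) (u : Dˣ) : PIrred (a * u) := by
  refine ⟨⟨by simpa using ha.1.1, by simpa using ha.1.2⟩, fun y z h => ?_⟩
  simpa using ha.2 y (z * ↑u⁻¹) (by rw [← mul_assoc, ← h, Units.mul_inv_cancel_right])

end Normal

/-- If `D` is an n-atomic domain, `x ∈ D^#`, and `A` is a facet of the
irreducible divisor simplicial complex `S(x)`, then `x` has a factorization into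
irreducibles whose factors represent exactly the association classes of `A`. -/
theorem facet_gives_factorization {D : Type*} [Ring D] [IsDomain D]
    (hD : NAtomic D) (x : D) (hx : NNU x) (A : Finset D)
    (hA : IsFace x A)
    (hmax : ∀ B : Finset D, IsFace x B → A ⊆ B → B = A) :
    ∃ f : List D, f ≠ [] ∧ (∀ y ∈ f, PIrred y) ∧ x = f.prod ∧
      (∀ y ∈ f, ∃ a ∈ A, PAssoc y a) ∧ (∀ a ∈ A, ∃ y ∈ f, PAssoc y a) := by
  classical
  obtain ⟨hirr, hna, l, hnd, hl, c, d, hcd⟩ := hA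
  obtain ⟨z, hz⟩ : ∃ z, x = l.prod * z := by
    obtain ⟨e, he⟩ := (hD.pNormal l.prod).exists_mul_eq_mul' c
    exact ⟨e * d, by rw [hcd, he, mul_assoc]⟩
  by_cases hu : IsUnit z
  · obtain ⟨u, rfl⟩ := hu
    rcases l.eq_nil_or_concat with rfl | ⟨t, b, rfl⟩
    · exact absurd (by simp [hz]) hx.2
    have hb : PAssoc (b * u) b := ⟨1, u, by simp⟩
    simp only [List.concat_eq_append, List.mem_append, List.mem_singleton] at hl
    refine ⟨t ++ [b * u], by simp, ?_, by simp [hz, mul_assoc], ?_, ?_⟩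
    · simp only [List.mem_append, List.mem_singleton]
      rintro y (hy | rfl)
      · exact (hirr y ((hl y).1 (.inl hy))).1
      · exact (hirr b ((hl b).1 (.inr rfl))).1.mul_unit u
    · simp only [List.mem_append, List.mem_singleton]
      rintro y (hy | rfl)
      · exact ⟨y, (hl y).1 (.inl hy), .refl y⟩
      · exact ⟨b, (hl b).1 (.inr rfl), hb⟩
    · intro a ha
      rcases (hl a).2 ha with h | rfl
      · exact ⟨a, by simp [h], .refl a⟩
      · exact ⟨a * u, by simp, hb⟩
  · have hz0 : z ≠ 0 := by
      rintro rfl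
      exact hx.1 (by simpa using hz)
    obtain ⟨q, hq, hqi, rfl⟩ := hD z ⟨hz0, hu⟩
    refine ⟨l ++ q, by simp [hq], ?_, by simp [hz], ?_, fun a ha =>
      ⟨a, List.mem_append_left _ ((hl a).2 ha), .refl a⟩⟩
    · intro y hy
      rcases List.mem_append.1 hy with h | h
      · exact (hirr y ((hl y).1 h)).1
      · exact (hqi y h).2
    · intro y hy
      rcases List.mem_append.1 hy with h | h
      · exact ⟨y, (hl y).1 h, .refl y⟩
      by_contra! hno
      have hyA : y ∉ A := fun hyA => hno y hyA (.refl y)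
      obtain ⟨s, t, hst⟩ := List.append_of_mem h
      obtain ⟨e, he⟩ := (hD.pNormal l.prod).exists_mul_eq_mul s.prod
      have hface : IsFace x (insert y A) := by
        refine ⟨?_, ?_, l ++ [y], ?_, ?_, e, t.prod, ?_⟩
        · intro a ha
          rcases Finset.mem_insert.1 ha with rfl | ha
          · exact ⟨(hqi _ h).2, l.prod * s.prod, t.prod, by simp [hz, hst, mul_assoc]⟩
          · exact hirr a ha
        · intro a ha b hb hab
          rcases Finset.mem_insert.1 ha with rfl | haA <;>
            rcases Finset.mem_insert.1 hb with rfl | hbA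
          · exact absurd rfl hab
          · exact hno b hbA
          · exact fun h' => hno a haA h'.symm
          · exact hna a haA b hbA hab
        · rw [← List.concat_eq_append]
          exact hnd.concat fun h' => hyA ((hl y).1 h')
        · intro a
          simp [hl, or_comm]
        · rw [hz, hst, List.prod_append, List.prod_cons, ← mul_assoc, he]
          simp [mul_assoc]
      exact hyA (hmax _ hface (Finset.subset_insert y A) ▸ Finset.mem_insert_self y A)
end

section
/- Let D be an n-UFD. Then for every x ∈ D^#, the face set of the irreducible divisor simplicial complex S(x) is the full power set of its vertex set: whenever y₁, …, y_n are pairwise nonassociate irreducible divisors of x, there is a permutation σ ∈ S_n such that y_{σ(1)}y_{σ(2)}⋯y_{σ(n)} ∣ x, so {y₁, …, y_n} is a face of S(x). -/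
theorem PDvd.trans {D : Type*} [Ring D] {a b c : D} (hab : PDvd a b) (hbc : PDvd b c) :
    PDvd a c := by
  obtain ⟨r, s, rfl⟩ := hab
  obtain ⟨t, u, rfl⟩ := hbc
  exact ⟨t * r, s * u, by simp only [mul_assoc]⟩

theorem PAssoc.pdvd {D : Type*} [Ring D] {a b : D} (h : PAssoc a b) : PDvd a b := by
  obtain ⟨u, v, rfl⟩ := h
  exact ⟨↑u⁻¹, ↑v⁻¹, by simp [mul_assoc]⟩

theorem pdvd_list_prod {D : Type*} [Ring D] {a : D} {l : List D} (h : a ∈ l) :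
    PDvd a l.prod := by
  obtain ⟨s, t, rfl⟩ := List.append_of_mem h
  exact ⟨s.prod, t.prod, by simp [mul_assoc]⟩

theorem PIrred.passoc_of_pdvd {D : Type*} [Ring D] [IsDomain D] {p q : D}
    (hp : PIrred p) (hq : PIrred q) (h : PDvd p q) : PAssoc q p := by
  obtain ⟨c, d, hcd⟩ := h
  have hd : IsUnit d := (hq.2 _ _ hcd).resolve_left
    fun hu => hp.1.2 (isUnit_of_mul_isUnit_right hu)
  have hc : IsUnit c := (hq.2 _ _ (hcd.trans (mul_assoc c p d))).resolve_right
    fun hu => hp.1.2 (isUnit_of_mul_isUnit_left hu)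
  obtain ⟨u, rfl⟩ := hc
  obtain ⟨v, rfl⟩ := hd
  exact ⟨u, v, hcd⟩

theorem PIrred.pnormal {D : Type*} [Ring D] [IsDomain D] (h : NAtomic D) {p : D}
    (hp : PIrred p) : PNormal p := by
  obtain ⟨l, hl, hnorm, hprod⟩ := h p hp.1
  match l, hl with
  | [a], _ =>
    rw [List.prod_singleton] at hprod
    exact hprod ▸ (hnorm a (by simp)).1
  | a :: b :: t, _ =>
    rw [List.prod_cons] at hprod
    rcases hp.2 _ _ hprod with ha | hb
    · exact absurd ha (hnorm a (by simp)).2.1.2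
    · rw [List.prod_cons] at hb
      exact absurd (isUnit_of_mul_isUnit_left hb) (hnorm b (by simp)).2.1.2

theorem PNormal.exists_mul_comm_left {D : Type*} [Ring D] {a : D} (ha : PNormal a) (c : D) :
    ∃ c', c * a = a * c' :=
  ha.symm.subset ⟨c, rfl⟩

theorem PNormal.exists_mul_comm_right {D : Type*} [Ring D] {a : D} (ha : PNormal a) (c : D) :
    ∃ c', a * c = c' * a :=
  ha.subset ⟨c, rfl⟩

/-- Irreducible elements of an n-UFD are prime with respect to `PDvd`. -/
theorem PIrred.pdvd_or_pdvd {D : Type*} [Ring D] [IsDomain D] (h : NUFD D) {p y z : D}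
    (hp : PIrred p) (hyz : y * z ≠ 0) (hdvd : PDvd p (y * z)) : PDvd p y ∨ PDvd p z := by
  have hpn := hp.pnormal h.1
  obtain ⟨c, d, hcd⟩ := hdvd
  by_cases hy : IsUnit y
  · obtain ⟨u, rfl⟩ := hy
    exact Or.inr ⟨↑u⁻¹ * c, d, by
      rw [mul_assoc, mul_assoc, ← mul_assoc c, ← hcd, Units.inv_mul_cancel_left]⟩
  by_cases hz : IsUnit z
  · obtain ⟨u, rfl⟩ := hz
    exact Or.inl ⟨c, d * ↑u⁻¹, by rw [← mul_assoc, ← hcd, Units.mul_inv_cancel_right]⟩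
  obtain ⟨c', hc'⟩ := hpn.exists_mul_comm_left c
  rw [hc', mul_assoc] at hcd
  have he0 : c' * d ≠ 0 := right_ne_zero_of_mul (hcd ▸ hyz)
  by_cases he : IsUnit (c' * d)
  · obtain ⟨u, hu⟩ := he
    have hpu : p = y * (z * ↑u⁻¹) := by
      rw [← mul_assoc, hcd, ← hu, Units.mul_inv_cancel_right]
    rcases hp.2 _ _ hpu with hy' | hz'
    · exact absurd hy' hy
    · exact absurd (isUnit_of_mul_isUnit_left hz') hz
  obtain ⟨ly, -, hly, rfl⟩ := h.1 y ⟨left_ne_zero_of_mul hyz, hy⟩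
  obtain ⟨lz, -, hlz, rfl⟩ := h.1 z ⟨right_ne_zero_of_mul hyz, hz⟩
  obtain ⟨le, -, hle, hprod⟩ := h.1 _ ⟨he0, he⟩
  obtain ⟨σ, hσ⟩ := h.2 (ly.prod * lz.prod) ⟨hyz, fun hu => hy (isUnit_of_mul_isUnit_left hu)⟩
    (p :: le) (ly ++ lz)
    ⟨by simpa only [List.forall_mem_cons] using ⟨⟨hpn, hp⟩, hle⟩,
      by rw [List.prod_cons, hcd, hprod]⟩
    ⟨by simpa only [List.forall_mem_append] using ⟨hly, hlz⟩, List.prod_append.symm⟩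
  have hassoc : PAssoc p ((ly ++ lz).get (σ ⟨0, by simp⟩)) := hσ ⟨0, by simp⟩
  rcases List.mem_append.1 (List.get_mem (ly ++ lz) (σ ⟨0, by simp⟩)) with hm | hm
  · exact Or.inl (hassoc.pdvd.trans (pdvd_list_prod hm))
  · exact Or.inr (hassoc.pdvd.trans (pdvd_list_prod hm))

/-- In an n-UFD, the product, in any order, of pairwise nonassociate irreducible divisors of
`x ≠ 0` divides `x`. -/
theorem NUFD.list_prod_pdvd {D : Type*} [Ring D] [IsDomain D] (h : NUFD D) {l : List D}
    (hl : l.Pairwise fun a b => ¬ PAssoc a b) {x : D} (hx : x ≠ 0)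
    (hdvd : ∀ a ∈ l, PIrred a ∧ PDvd a x) : PDvd l.prod x := by
  induction l generalizing x with
  | nil => exact ⟨x, 1, by simp⟩
  | cons a l ih =>
    obtain ⟨hal, hl⟩ := List.pairwise_cons.1 hl
    obtain ⟨⟨ha, c, d, rfl⟩, hdvd⟩ := List.forall_mem_cons.1 hdvd
    have han := ha.pnormal h.1
    obtain ⟨c', hc'⟩ := han.exists_mul_comm_left c
    rw [hc', mul_assoc] at hx hdvd ⊢
    obtain ⟨e, f, hef⟩ := ih hl (right_ne_zero_of_mul hx) fun b hb =>
      ⟨(hdvd b hb).1, ((hdvd b hb).1.pdvd_or_pdvd h hx (hdvd b hb).2).resolve_left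
        fun hba => hal b hb ((hdvd b hb).1.passoc_of_pdvd ha hba)⟩
    obtain ⟨e', he'⟩ := han.exists_mul_comm_right e
    exact ⟨e', f, by rw [hef, List.prod_cons, ← mul_assoc, ← mul_assoc, he', mul_assoc e']⟩

/-- In an n-UFD, every finite set of pairwise nonassociate irreducible
divisors of `x ∈ D^#` is a face of `S(x)`. -/
theorem nufd_faces_powerset {D : Type*} [Ring D] [IsDomain D]
    (h : NUFD D) (x : D) (hx : NNU x) (A : Finset D)
    (hvert : ∀ a ∈ A, PIrred a ∧ PDvd a x)
    (hnonassoc : ∀ a ∈ A, ∀ b ∈ A, a ≠ b → ¬ PAssoc a b) :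
    IsFace x A := by
  refine ⟨hvert, hnonassoc, A.toList, A.nodup_toList, fun _ => Finset.mem_toList,
    h.list_prod_pdvd ?_ hx.1 fun a ha => hvert a (Finset.mem_toList.1 ha)⟩
  exact A.nodup_toList.imp_of_mem fun ha hb hab =>
    hnonassoc _ (Finset.mem_toList.1 ha) _ (Finset.mem_toList.1 hb) hab
end

section
/- Let D be a domain with a symmetric and associate preserving relation τ on D^#, let x be a normal τ-irreducible element of D, and suppose r, r′ ∈ D satisfy x·r = r′·x. Then r is a normal element of D if and only if r′ is a normal element of D. -/
/-- `l` (together with some unit `λ`) is a τ-factorization of `a`: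
`a = λ * a₁ * ⋯ * a_m`, each `a_i ∈ D^#`, and `a_i τ a_j` for all `i ≠ j`. -/
def TauFac {D : Type*} [Ring D] (τ : D → D → Prop) (a : D) (l : List D) : Prop :=
  l ≠ [] ∧ (∀ b ∈ l, NNU b) ∧
  (∀ i j : Fin l.length, i ≠ j → τ (l.get i) (l.get j)) ∧
  ∃ u : Dˣ, a = (u : D) * l.prod

/-- `b` τ-divides `a`: `b` is a τ-factor in some τ-factorization of `a`. -/
def TauDvd {D : Type*} [Ring D] (τ : D → D → Prop) (b a : D) : Prop :=
  ∃ l : List D, TauFac τ a l ∧ b ∈ l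

/-- `x` is τ-irreducible: every τ-factorization of `x` is trivial (`m = 1`). -/
def TauIrred {D : Type*} [Ring D] (τ : D → D → Prop) (x : D) : Prop :=
  NNU x ∧ ∀ l : List D, TauFac τ x l → l.length = 1

/-- τ is associate preserving: `a τ b` and `b ~ b'` imply `a τ b'`. -/
def AssocPres {D : Type*} [Ring D] (τ : D → D → Prop) : Prop :=
  ∀ a b b' : D, τ a b → PAssoc b b' → τ a b'

theorem pNormal_iff {D : Type*} [Ring D] {a : D} :
    PNormal a ↔ (∀ d, ∃ e, a * d = e * a) ∧ ∀ d, ∃ e, d * a = a * e := by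
  unfold PNormal
  constructor
  · intro h
    exact ⟨fun d => h.subset ⟨d, rfl⟩, fun d => h.superset ⟨d, rfl⟩⟩
  · rintro ⟨h₁, h₂⟩
    ext y
    constructor
    · rintro ⟨d, rfl⟩
      exact h₁ d
    · rintro ⟨d, rfl⟩
      exact h₂ d

/-- If `x` is a normal τ-irreducible element and `x * r = r' * x`,
then `r` is normal iff `r'` is normal. -/
theorem normal_iff_of_normal_commute {D : Type*} [Ring D] [IsDomain D]
    (τ : D → D → Prop) (hsym : Symmetric τ) (hap : AssocPres τ)
    (x : D) (hn : PNormal x) (hi : TauIrred τ x)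
    (r r' : D) (h : x * r = r' * x) :
    PNormal r ↔ PNormal r' := by
  have hx : x ≠ 0 := hi.1.1
  obtain ⟨hl, hr⟩ := pNormal_iff.mp hn
  rw [pNormal_iff, pNormal_iff]
  constructor
  · rintro ⟨h₁, h₂⟩
    refine ⟨fun d => ?_, fun d => ?_⟩ <;> obtain ⟨d₀, hd⟩ := hr d
    · obtain ⟨e, he⟩ := h₁ d₀
      obtain ⟨e', he'⟩ := hl e
      refine ⟨e', mul_right_cancel₀ hx ?_⟩
      rw [mul_assoc, hd, ← mul_assoc, ← h, mul_assoc, he, ← mul_assoc, he', mul_assoc, h,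
        ← mul_assoc]
    · obtain ⟨e, he⟩ := h₂ d₀
      obtain ⟨e', he'⟩ := hl e
      refine ⟨e', mul_right_cancel₀ hx ?_⟩
      rw [mul_assoc, ← h, ← mul_assoc, hd, mul_assoc, he, ← mul_assoc, h, mul_assoc, he',
        ← mul_assoc]
  · rintro ⟨h₁, h₂⟩
    refine ⟨fun d => ?_, fun d => ?_⟩ <;> obtain ⟨d', hd⟩ := hl d
    · obtain ⟨e, he⟩ := h₁ d'
      obtain ⟨e₀, he₀⟩ := hr e
      refine ⟨e₀, mul_left_cancel₀ hx ?_⟩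
      rw [← mul_assoc, h, mul_assoc, hd, ← mul_assoc, he, mul_assoc, ← h, ← mul_assoc, he₀,
        mul_assoc]
    · obtain ⟨e, he⟩ := h₂ d'
      obtain ⟨e₀, he₀⟩ := hr e
      refine ⟨e₀, mul_left_cancel₀ hx ?_⟩
      rw [← mul_assoc, hd, mul_assoc, h, ← mul_assoc, he, mul_assoc, he₀, ← mul_assoc, ← h,
        mul_assoc]
end
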